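/- There exists a real number g in the open interval (0, 1/5), a real number λ with −1 < λ < 0, three pairwise distinct real numbers η₁, η₂, η₃, and an invertible 6×6 complex matrix Q such that Q⁻¹ · H_toy(g,λ) · Q equals the block-diagonal direct sum J^{(2)}(η₁) ⊕ J^{(2)}(η₂) ⊕ J^{(2)}(η₃). That is, the family H_toy(g,λ) possesses an exceptional point EP6 = EP2 ⊕ EP2 ⊕ EP2 of algebraic multiplicity 6 and geometric multiplicity K = 3 at some g^(EP6) ∈ (0, 1/5). -/

import Mathlib

open Matrix Polynomial

/-- The `6 × 6` real matrix `H_toy(g,λ)`: diagonal `(−5+g, −3, −1, 1, 3, 5−g)`,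
superdiagonal `(√(5+5λ), 2√(2+2λ), 3√(1+λ), 2√(2+2λ), √(5+5λ))`, subdiagonal the
negatives of the corresponding superdiagonal entries, all other entries zero. -/
noncomputable def Htoy (g lam : ℝ) : Matrix (Fin 6) (Fin 6) ℝ :=
  !![-5+g, Real.sqrt (5+5*lam), 0, 0, 0, 0;
     -Real.sqrt (5+5*lam), -3, 2*Real.sqrt (2+2*lam), 0, 0, 0;
     0, -(2*Real.sqrt (2+2*lam)), -1, 3*Real.sqrt (1+lam), 0, 0;
     0, 0, -(3*Real.sqrt (1+lam)), 1, 2*Real.sqrt (2+2*lam), 0;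
     0, 0, 0, -(2*Real.sqrt (2+2*lam)), 3, Real.sqrt (5+5*lam);
     0, 0, 0, 0, -Real.sqrt (5+5*lam), 5-g]

/-- Characteristic polynomials of the leading principal blocks of the tridiagonal matrix with
diagonal `(-a, -3, -1, 1, 3, a)` and products `(-α, -β, -γ, -β, -α)` of off-diagonal entries. -/
noncomputable def leadingCharpoly {K : Type*} [Field K] (α β γ a : K) : ℕ → K[X]
  | 0 => 1
  | 1 => X + C a
  | 2 => (X + 3) * leadingCharpoly α β γ a 1 + C α
  | 3 => (X + 1) * leadingCharpoly α β γ a 2 + C β * leadingCharpoly α β γ a 1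
  | 4 => (X - 1) * leadingCharpoly α β γ a 3 + C γ * leadingCharpoly α β γ a 2
  | 5 => (X - 3) * leadingCharpoly α β γ a 4 + C β * leadingCharpoly α β γ a 3
  | 6 => (X - C a) * leadingCharpoly α β γ a 5 + C α * leadingCharpoly α β γ a 4
  | _ => 0

/-- Rows of values and first derivatives of `f 0, …, f 5` at the nodes `0`, `η`, `-η`. -/
noncomputable def confluentMatrix {K : Type*} [Field K] (f : ℕ → K[X]) (η : K) :
    Matrix (Fin 6) (Fin 6) K :=
  .of fun i => ![(f i).eval 0, (derivative (f i)).eval 0, (f i).eval η,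
    (derivative (f i)).eval η, (f i).eval (-η), (derivative (f i)).eval (-η)]

theorem isUnit_confluentMatrix_leadingCharpoly {K : Type*} [Field K] [CharZero K]
    (α β γ a : K) {η : K} (hη : η ≠ 0) :
    IsUnit (confluentMatrix (leadingCharpoly α β γ a) η) := by
  rw [← Matrix.mulVec_injective_iff_isUnit]
  refine (injective_iff_map_eq_zero (Matrix.mulVecLin _)).2 fun c hc => ?_
  have h0 := congrFun hc 0
  have h1 := congrFun hc 1
  have h2 := congrFun hc 2
  have h3 := congrFun hc 3
  have h4 := congrFun hc 4
  have h5 := congrFun hc 5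
  simp [confluentMatrix, Matrix.mulVec, dotProduct, Fin.sum_univ_succ, leadingCharpoly]
    at h0 h1 h2 h3 h4 h5
  have m1 : η * (c 2 - c 4) + (c 1 + c 3 + c 5) = 0 := by
    linear_combination h1 - a * h0
  have m2 : η ^ 2 * (c 2 + c 4) + 2 * η * (c 3 - c 5) = 0 := by
    linear_combination h2 - (a + 3) * m1 - (3 * a + α) * h0
  have m3 : η ^ 3 * (c 2 - c 4) + 3 * η ^ 2 * (c 3 + c 5) = 0 := by
    linear_combination h3 - (a + 4) * m2 - (4 * a + 3 + α + β) * m1 - (3 * a + α + a * β) * h0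
  have m4 : η ^ 4 * (c 2 + c 4) + 4 * η ^ 3 * (c 3 - c 5) = 0 := by
    linear_combination h4 - (a + 3) * m3 - (3 * a - 1 + α + β + γ) * m2 -
      ((a + 3) * (γ - 1) + (a - 1) * β) * m1 -
      ((3 * a + α) * γ - (3 * a + α + a * β)) * h0
  have m5 : η ^ 5 * (c 2 - c 4) + 5 * η ^ 4 * (c 3 + c 5) = 0 := by
    linear_combination h5 - a * m4 - (2 * β + α + γ - 10) * m3 -
      (((a + 3) * (γ - 1) + (a - 1) * β) - 3 * (3 * a - 1 + α + β + γ) + β * (a + 4)) * m2 -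
      (((3 * a + α) * γ - (3 * a + α + a * β)) - 3 * ((a + 3) * (γ - 1) + (a - 1) * β) +
        β * (4 * a + 3 + α + β)) * m1 -
      (β * (3 * a + α + a * β) - 3 * ((3 * a + α) * γ - (3 * a + α + a * β))) * h0
  have e1 : c 3 - c 5 = 0 := by
    have : 2 * η ^ 3 * (c 3 - c 5) = 0 := by linear_combination m4 - η ^ 2 * m2
    simpa [hη] using this
  have e2 : c 3 + c 5 = 0 := by
    have : 2 * η ^ 4 * (c 3 + c 5) = 0 := by linear_combination m5 - η ^ 2 * m3
    simpa [hη] using this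
  have e3 : c 2 + c 4 = 0 := by
    have : η ^ 2 * (c 2 + c 4) = 0 := by linear_combination m2 - 2 * η * e1
    simpa [hη] using this
  have e4 : c 2 - c 4 = 0 := by
    have : η ^ 3 * (c 2 - c 4) = 0 := by linear_combination m3 - 3 * η ^ 2 * e2
    simpa [hη] using this
  ext i
  fin_cases i
  · change c 0 = 0
    linear_combination h0 - e3
  · change c 1 = 0
    linear_combination m1 - η * e4 - e2
  · change c 2 = 0
    linear_combination (e3 + e4) / 2
  · change c 3 = 0
    linear_combination (e1 + e2) / 2
  · change c 4 = 0
    linear_combination (e3 - e4) / 2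
  · change c 5 = 0
    linear_combination (e2 - e1) / 2

/-- The tridiagonal matrix with diagonal `(-a, -3, -1, 1, 3, a)`, superdiagonal `(p, q, r, q, p)`
and subdiagonal `(-p, -q, -r, -q, -p)`. -/
def tridiagonal {K : Type*} [Field K] (p q r a : K) : Matrix (Fin 6) (Fin 6) K :=
  !![-a, p, 0, 0, 0, 0;
     -p, -3, q, 0, 0, 0;
     0, -q, -1, r, 0, 0;
     0, 0, -r, 1, q, 0;
     0, 0, 0, -q, 3, p;
     0, 0, 0, 0, -p, a]

/-- If the characteristic polynomial is `x² (x² - η²)²`, then the tridiagonal matrix is similar to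
a direct sum of three Jordan blocks of size two. -/
theorem exists_tridiagonal_similar_jordan {K : Type*} [Field K] [CharZero K] {p q r a η : K}
    (hp : p ≠ 0) (hq : q ≠ 0) (hr : r ≠ 0) (hη : η ≠ 0)
    (hchar : leadingCharpoly (p ^ 2) (q ^ 2) (r ^ 2) a 6 = X ^ 2 * (X ^ 2 - C (η ^ 2)) ^ 2) :
    ∃ Q : Matrix (Fin 6) (Fin 6) K, IsUnit Q ∧
      Q⁻¹ * tridiagonal p q r a * Q =
        !![0, 1, 0, 0, 0, 0;
           0, 0, 0, 0, 0, 0;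
           0, 0, η, 1, 0, 0;
           0, 0, 0, η, 0, 0;
           0, 0, 0, 0, -η, 1;
           0, 0, 0, 0, 0, -η] := by
  set H := tridiagonal p q r a with hH
  let s : Fin 6 → K := ![p ^ 2 * q ^ 2 * r, p * q ^ 2 * r, p * q * r, p * q, p, 1]
  let f := leadingCharpoly (p ^ 2) (q ^ 2) (r ^ 2) a
  have hs : IsUnit (diagonal s) := by
    simp [Matrix.isUnit_iff_isUnit_det, Fin.prod_univ_succ, s, hp, hq, hr]
  have hQ : IsUnit (diagonal s * confluentMatrix f η) :=
    hs.mul (isUnit_confluentMatrix_leadingCharpoly _ _ _ _ hη)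
  have hC : (C 3 : Polynomial K) = 3 := map_ofNat C 3
  obtain ⟨t, hrec⟩ : ∃ t : Fin 6 → K, ∀ i, ∑ j, C (H i j) * (C (s j) * f j) =
      X * (C (s i) * f i) - C (t i) * f 6 := by
    refine ⟨![0, 0, 0, 0, 0, 1], fun i => ?_⟩
    fin_cases i <;>
      simp [hH, tridiagonal, Fin.sum_univ_succ, s, f, leadingCharpoly, hC] <;> ring
  have hval {x : K} (hx : x * (x ^ 2 - η ^ 2) = 0) (i : Fin 6) :
      ∑ j, H i j * (s j * (f j).eval x) = s i * (f i).eval x * x := by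
    have := congrArg (eval x) (hrec i)
    simp only [f, hchar] at this
    simp [eval_finsetSum] at this
    linear_combination this - t i * x * (x ^ 2 - η ^ 2) * hx
  have hder {x : K} (hx : x * (x ^ 2 - η ^ 2) = 0) (i : Fin 6) :
      ∑ j, H i j * (s j * (derivative (f j)).eval x) =
        s i * (f i).eval x + s i * (derivative (f i)).eval x * x := by
    have := congrArg (fun g => eval x (derivative g)) (hrec i)
    simp only [f, hchar] at this
    simp [eval_finsetSum, derivative_pow] at this
    linear_combination this - t i * (6 * x ^ 2 - 2 * η ^ 2) * hx
  refine ⟨_, hQ, ?_⟩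
  suffices h : H * (diagonal s * confluentMatrix f η) = (diagonal s * confluentMatrix f η) * _ by
    rw [Matrix.mul_assoc, h, nonsing_inv_mul_cancel_left _ _ ((isUnit_iff_isUnit_det _).1 hQ)]
  have h0 : (0 : K) * (0 ^ 2 - η ^ 2) = 0 := by ring
  have hpos : η * (η ^ 2 - η ^ 2) = 0 := by ring
  have hneg : -η * ((-η) ^ 2 - η ^ 2) = 0 := by ring
  ext i j
  rw [Matrix.mul_apply, Matrix.mul_apply]
  simp only [Matrix.diagonal_mul]
  fin_cases j
  · refine (hval h0 i).trans ?_
    simp [Fin.sum_univ_succ, confluentMatrix]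
  · refine (hder h0 i).trans ?_
    simp [Fin.sum_univ_succ, confluentMatrix]
  · refine (hval hpos i).trans ?_
    simp [Fin.sum_univ_succ, confluentMatrix]
  · refine (hder hpos i).trans ?_
    simp [Fin.sum_univ_succ, confluentMatrix]
  · refine (hval hneg i).trans ?_
    simp [Fin.sum_univ_succ, confluentMatrix]
  · refine (hder hneg i).trans ?_
    simp [Fin.sum_univ_succ, confluentMatrix]

/-- Parameters at which the characteristic polynomial is `x² (x² - η²)²`. -/
theorem exists_parameters :
    ∃ a w η : ℝ, 24 / 5 < a ∧ a < 5 ∧ 0 < w ∧ w < 1 ∧ 0 < η ∧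
      35 * w ^ 2 - 10 - a ^ 2 = -2 * η ^ 2 ∧
      10 * a ^ 2 + 9 + w ^ 2 * (30 * a - 43 - 25 * a ^ 2) + 259 * w ^ 4 = η ^ 4 ∧
      a * (3 + 8 * w ^ 2) + 5 * w ^ 2 = 3 * w * (3 * a + 5 * w ^ 2) := by
  have hD (w : ℝ) : 0 < 8 * w ^ 2 - 9 * w + 3 := by nlinarith [sq_nonneg (16 * w - 9)]
  let a : ℝ → ℝ := fun w => 5 * w ^ 2 * (3 * w - 1) / (8 * w ^ 2 - 9 * w + 3)
  let F : ℝ → ℝ := fun w => (35 * w ^ 2 - 10 - a w ^ 2) ^ 2 -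
    4 * (10 * a w ^ 2 + 9 + w ^ 2 * (30 * a w - 43 - 25 * a w ^ 2) + 259 * w ^ 4)
  have ha : Continuous a := Continuous.div (by fun_prop) (by fun_prop) fun w => (hD w).ne'
  have hF : Continuous F := by fun_prop
  obtain ⟨w, ⟨hw0, hw1⟩, hw⟩ : (0 : ℝ) ∈ F '' Set.Icc (87 / 100) (88 / 100) :=
    intermediate_value_Icc (by norm_num) hF.continuousOn
      ⟨by norm_num [F, a], by norm_num [F, a]⟩
  have haw : a w * (8 * w ^ 2 - 9 * w + 3) = 5 * w ^ 2 * (3 * w - 1) :=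
    div_mul_cancel₀ _ (hD w).ne'
  have hgap : (5 - a w) * (8 * w ^ 2 - 9 * w + 3) = 15 * (1 - w) ^ 3 := by
    linear_combination -haw
  have hlt : a w < 5 := by
    have : 0 < 15 * (1 - w) ^ 3 := by
      have : 0 < 1 - w := by linarith
      positivity
    have := pos_of_mul_pos_left (hgap ▸ this) (hD w).le
    linarith
  have hgt : 24 / 5 < a w := by
    have : (1 - w) ^ 3 ≤ (13 / 100) ^ 3 := pow_le_pow_left₀ (by linarith) (by linarith) 3
    have hD1 : 1 ≤ 8 * w ^ 2 - 9 * w + 3 := by nlinarith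
    by_contra! h
    nlinarith [mul_nonneg (sub_nonneg.2 h) (hD w).le]
  have hA : 0 < (a w ^ 2 + 10 - 35 * w ^ 2) / 2 := by nlinarith
  have hsq := Real.sq_sqrt hA.le
  refine ⟨a w, w, _, hgt, hlt, by linarith, by linarith, Real.sqrt_pos.2 hA, ?_, ?_, ?_⟩
  · rw [hsq]; ring
  · have hw' : F w = 0 := hw
    simp only [F] at hw'
    rw [show (4 : ℕ) = 2 * 2 from rfl, pow_mul √_, hsq]
    linear_combination -hw' / 4
  · linear_combination haw

/-- Factorization of the characteristic polynomial at the parameters of `exists_parameters`. -/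
theorem leadingCharpoly_six_eq {K : Type*} [Field K] {a w η : K}
    (h₁ : 35 * w ^ 2 - 10 - a ^ 2 = -2 * η ^ 2)
    (h₂ : 10 * a ^ 2 + 9 + w ^ 2 * (30 * a - 43 - 25 * a ^ 2) + 259 * w ^ 4 = η ^ 4)
    (h₃ : a * (3 + 8 * w ^ 2) + 5 * w ^ 2 = 3 * w * (3 * a + 5 * w ^ 2)) :
    leadingCharpoly (5 * w ^ 2) (8 * w ^ 2) (9 * w ^ 2) a 6 =
      X ^ 2 * (X ^ 2 - C (η ^ 2)) ^ 2 := by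
  have k₁ := congrArg (C : K → Polynomial K) h₁
  have k₂ := congrArg (C : K → Polynomial K) h₂
  have k₃ := congrArg (C : K → Polynomial K) h₃
  simp only [map_add, map_sub, map_mul, map_neg, map_pow, map_ofNat] at k₁ k₂ k₃
  simp only [leadingCharpoly, map_mul, map_pow, map_ofNat]
  linear_combination X ^ 4 * k₁ + X ^ 2 * k₂ -
    (C a * (3 + 8 * C w ^ 2) + 5 * C w ^ 2 + 3 * C w * (3 * C a + 5 * C w ^ 2)) * k₃

/-- There exist `g ∈ (0, 1/5)`, `λ ∈ (−1, 0)`, pairwise distinct real `η₁, η₂, η₃`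
and an invertible complex matrix `Q` such that `Q⁻¹ · H_toy(g,λ) · Q` is the direct
sum `J^{(2)}(η₁) ⊕ J^{(2)}(η₂) ⊕ J^{(2)}(η₃)`: an exceptional point EP6 of algebraic
multiplicity 6 and geometric multiplicity `K = 3`. -/
theorem stmt17 :
    ∃ (g lam η₁ η₂ η₃ : ℝ) (Q : Matrix (Fin 6) (Fin 6) ℂ),
      0 < g ∧ g < 1/5 ∧ -1 < lam ∧ lam < 0 ∧
      η₁ ≠ η₂ ∧ η₁ ≠ η₃ ∧ η₂ ≠ η₃ ∧ IsUnit Q ∧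
      Q⁻¹ * (Htoy g lam).map ((↑) : ℝ → ℂ) * Q =
        !![(η₁ : ℂ), 1, 0, 0, 0, 0;
           0, (η₁ : ℂ), 0, 0, 0, 0;
           0, 0, (η₂ : ℂ), 1, 0, 0;
           0, 0, 0, (η₂ : ℂ), 0, 0;
           0, 0, 0, 0, (η₃ : ℂ), 1;
           0, 0, 0, 0, 0, (η₃ : ℂ)] := by
  obtain ⟨a, w, η, ha, ha', hw, hw', hη, h₁, h₂, h₃⟩ := exists_parameters
  have hw2 : 0 < w ^ 2 := by positivity
  have hp : (√(5 + 5 * (w ^ 2 - 1))) ^ 2 = 5 * w ^ 2 := by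
    rw [Real.sq_sqrt] <;> nlinarith
  have hq : (2 * √(2 + 2 * (w ^ 2 - 1))) ^ 2 = 8 * w ^ 2 := by
    rw [mul_pow, Real.sq_sqrt] <;> nlinarith
  have hr : (3 * √(1 + (w ^ 2 - 1))) ^ 2 = 9 * w ^ 2 := by
    rw [mul_pow, Real.sq_sqrt] <;> nlinarith
  have hne {x y : ℝ} (h : x ^ 2 = y) (hy : 0 < y) : (x : ℂ) ≠ 0 := by
    intro hx
    rw [Complex.ofReal_eq_zero] at hx
    simp [hx] at h
    exact hy.ne h
  have hchar := leadingCharpoly_six_eq (K := ℂ) (a := a) (w := w) (η := η)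
    (by exact_mod_cast h₁) (by exact_mod_cast h₂) (by exact_mod_cast h₃)
  have hpC := congrArg ((↑) : ℝ → ℂ) hp
  have hqC := congrArg ((↑) : ℝ → ℂ) hq
  have hrC := congrArg ((↑) : ℝ → ℂ) hr
  rw [Complex.ofReal_pow] at hpC hqC hrC
  obtain ⟨Q, hQ, hJ⟩ := exists_tridiagonal_similar_jordan (a := (a : ℂ))
    (hne hp (by positivity)) (hne hq (by positivity)) (hne hr (by positivity))
    (Complex.ofReal_ne_zero.2 hη.ne') (by rw [hpC, hqC, hrC]; exact_mod_cast hchar)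
  refine ⟨5 - a, w ^ 2 - 1, 0, η, -η, Q, by linarith, by linarith, by linarith, by nlinarith,
    hη.ne, by linarith, by linarith, hQ, ?_⟩
  convert hJ using 3
  · ext i j
    fin_cases i <;> fin_cases j <;> simp [Htoy, tridiagonal]
    ring
  all_goals simp
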